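/- Let u ∈ ℕ₊ be even, m ∈ ℕ₊, and let R be a ring. Define the filter bank w^ZOH ∈ ((R^m)^m)^{2u} by ((w^ZOH_μ)_λ)_κ := 1 if λ = κ and μ ∈ {1+u/2,…,u+u/2}, and 0 otherwise, for λ, κ ∈ {1,…,m} and μ ∈ {1,…,2u}. Then for every non-empty signal ξ ∈ (R^m)^D (D ≥ 1), TransposedConvolution_{(w^ZOH, u, u/2)}(ξ) = Upsampling_u(ξ); that is, transposed convolution with w^ZOH, stride u and padding size u/2 carries out upsampling with zero-order hold. -/

import Mathlib

namespace Scan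

/-- Multi-channel convolution `ξ ∗ w` of a signal `ξ ∈ (R^m)^D` with a filter bank
`w ∈ ((R^n)^m)^c`: in 1-based indexing, `(ξ ∗ w)_i = ∑_λ ∑_μ (w_μ)_λ · (ξ_{c+i−μ})_λ`. -/
def mconv {R : Type*} [Ring R] {m n c : ℕ} (w : Fin c → Fin m → Fin n → R)
    {D : ℕ} (ξ : Fin D → Fin m → R) : Fin (D + 1 - c) → Fin n → R :=
  fun i κ => ∑ lam : Fin m, ∑ μ : Fin c,
    w μ lam κ * ξ ⟨c - 1 - μ.val + i.val, by
      have h1 := i.isLt; have h2 := μ.isLt; omega⟩ lam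

/-- Zero padding: prepend and append `P` zero samples (Dirichlet boundary
conditions). -/
def padZ {V : Type*} [Zero V] (P : ℕ) {D : ℕ} (ξ : Fin D → V) : Fin (D + 2 * P) → V :=
  fun i => if h : P ≤ i.val ∧ i.val < P + D then ξ ⟨i.val - P, by omega⟩ else 0

/-- Cropping: remove `P` samples from both ends. -/
def crop {V : Type*} (P : ℕ) {D : ℕ} (ξ : Fin D → V) : Fin (D - 2 * P) → V :=
  fun i => ξ ⟨i.val + P, by have := i.isLt; omega⟩

/-- The spreading operator: insert `k − 1` zeros between the samples of the
input signal. -/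
def spread {V : Type*} [Zero V] (k : ℕ) {D : ℕ} (ξ : Fin D → V) :
    Fin (k * (D - 1) + 1) → V :=
  fun ν => if h : ν.val % k = 0 ∧ ν.val / k < D then ξ ⟨ν.val / k, h.2⟩ else 0

/-- The transposed convolution operator
`TransposedConvolution_{(w,k,P)}(ξ) = Crop_P(Pad_{c−1}(Spread_k(ξ)) ∗ w)`. -/
def transConv {R : Type*} [Ring R] {m n cc : ℕ} (w : Fin cc → Fin m → Fin n → R)
    (k P : ℕ) {D : ℕ} (ξ : Fin D → Fin m → R) :
    Fin (k * (D - 1) + 1 + 2 * (cc - 1) + 1 - cc - 2 * P) → Fin n → R :=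
  crop P (mconv w (padZ (cc - 1) (spread k ξ)))

/-- The upsampling operator with zero-order hold. -/
def upsample {M : Type*} (k : ℕ) {q : ℕ} (ξ : Fin q → M) : Fin (k * q) → M :=
  fun ν => ξ ⟨ν.val / k, Nat.div_lt_of_lt_mul ν.isLt⟩

theorem padZ_of_val_eq_add {V : Type*} [Zero V] {P D : ℕ} (ξ : Fin D → V)
    (i : Fin (D + 2 * P)) (j : Fin D) (h : i.val = j.val + P) : padZ P ξ i = ξ j := by
  have hj := j.isLt
  rw [padZ, dif_pos (by omega)]
  congr 1
  ext
  simp [h]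

theorem spread_of_val_eq_mul {V : Type*} [Zero V] {k D : ℕ} (hk : 0 < k) (ξ : Fin D → V)
    (i : Fin (k * (D - 1) + 1)) (j : Fin D) (h : i.val = k * j.val) : spread k ξ i = ξ j := by
  have hdiv : i.val / k = j.val := by rw [h, Nat.mul_div_cancel_left _ hk]
  rw [spread, dif_pos ⟨by rw [h, Nat.mul_mod_right], hdiv ▸ j.isLt⟩]
  congr 1
  ext
  exact hdiv

theorem padZ_spread_eq_zero {V : Type*} [Zero V] {k P D : ℕ} (ξ : Fin D → V)
    (i : Fin (k * (D - 1) + 1 + 2 * P)) (h : ∀ q, i.val ≠ k * q + P) :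
    padZ P (spread k ξ) i = 0 := by
  unfold padZ
  split_ifs with hi
  · refine dif_neg fun hν => h ((i.val - P) / k) ?_
    have := Nat.mul_div_cancel' (Nat.dvd_of_mod_eq_zero hν.1)
    dsimp only at this
    omega
  · rfl

/-- transposed convolution with the filter bank `w^ZOH` (spatial
extent `2u`, stride `u`, padding size `u/2`) carries out upsampling with
zero-order hold: the output has `u·D` samples and coincides sample-wise with
`Upsampling_u(ξ)`.  (In 1-based indexing the nonvanishing filter entries are at
positions `μ ∈ {1+u/2,…,u+u/2}`; 0-based below: `u/2 ≤ μ < u + u/2`.) -/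
theorem transConv_zoh_eq_upsample {R : Type*} [Ring R] (u m : ℕ)
    (hu : 0 < u) (hue : 2 ∣ u)
    (w : Fin (2 * u) → Fin m → Fin m → R)
    (hw : ∀ (μ : Fin (2 * u)) (lam κ : Fin m),
      w μ lam κ = if lam = κ ∧ u / 2 ≤ μ.val ∧ μ.val < u + u / 2 then 1 else 0)
    {D : ℕ} (hD : 1 ≤ D) (ξ : Fin D → Fin m → R) :
    (u * (D - 1) + 1 + 2 * (2 * u - 1) + 1 - 2 * u - 2 * (u / 2) = u * D) ∧
    (∀ (i : ℕ)
      (h1 : i < u * (D - 1) + 1 + 2 * (2 * u - 1) + 1 - 2 * u - 2 * (u / 2))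
      (h2 : i < u * D),
      transConv w u (u / 2) ξ ⟨i, h1⟩ = upsample u ξ ⟨i, h2⟩) := by
  obtain ⟨v, rfl⟩ := hue
  have hv : 2 * v / 2 = v := by omega
  obtain ⟨d, rfl⟩ := Nat.exists_eq_add_of_le' hD
  refine ⟨?_, fun i h1 h2 => ?_⟩
  · rw [hv, Nat.add_sub_cancel, Nat.mul_succ]
    omega
  have hmod := Nat.mod_lt i hu
  have hdecomp := Nat.div_add_mod i (2 * v)
  have hq : i / (2 * v) < d + 1 := Nat.div_lt_of_lt_mul h2
  have hle : 2 * v * (i / (2 * v)) ≤ 2 * v * d := Nat.mul_le_mul_left _ (by omega)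
  ext κ
  simp only [transConv, crop, mconv, upsample, hw, hv]
  rw [Finset.sum_eq_single κ, Finset.sum_eq_single ⟨i % (2 * v) + v, by omega⟩]
  · rw [if_pos ⟨rfl, by dsimp only; omega, by dsimp only; omega⟩, one_mul,
      padZ_of_val_eq_add _ _ ⟨2 * v * (i / (2 * v)), by rw [Nat.add_sub_cancel]; omega⟩
        (by dsimp only; omega),
      spread_of_val_eq_mul hu _ _ ⟨i / (2 * v), hq⟩ rfl]
  · intro μ _ hμ
    split_ifs with hc
    · rw [padZ_spread_eq_zero, Pi.zero_apply, mul_zero]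
      intro q hq'
      refine hμ (Fin.ext ?_)
      have hi : i = (μ.val - v) + 2 * v * q := by
        dsimp only at hq'
        omega
      have hr : i % (2 * v) = μ.val - v := by
        rw [hi, Nat.add_mul_mod_self_left, Nat.mod_eq_of_lt (by omega)]
      dsimp only
      omega
    · exact zero_mul _
  · simp
  · intro lam _ hlam
    simp [hlam]
  · simp

end Scan
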